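/- arXiv:2308.11872 — 12 statements merged into one kernel-verified Lean document; each statement's English description precedes it below -/
import Mathlib

section
/- Let a, b be rational numbers with a*b*(4b^4 - a^4) ≠ 0. Set n = a^4 + 4b^4, x̄ = a^8 + 24a^4b^4 + 16b^8, ȳ = 4ab(4b^4 - a^4), z̄ = a^8 + 8a^6b^2 - 8a^4b^4 + 32a^2b^6 + 16b^8, w̄ = a^8 - 8a^6b^2 - 8a^4b^4 - 32a^2b^6 + 16b^8, and define U = (x̄/ȳ)^2 and V = x̄·z̄·w̄/ȳ^3. Then the rationals x = U^2 + 2nU - n^2, y = U^2 - 2nU - n^2, z = 4abV, u = U^2 + n^2, v = 2a^2V, w = 4b^2V satisfy x^4 + y^4 - z^4 = 2u^4 + 2v^4 + 2w^4. -/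
/-- Theorem 1.1 (equation x⁴ + y⁴ - z⁴ = 2u⁴ + 2v⁴ + 2w⁴): explicit rational
parametric solution with parameters `a`, `b`. -/
theorem diag_quartic_param_xyz_2uvw
    (a b : ℚ) (hab : a * b * (4 * b ^ 4 - a ^ 4) ≠ 0)
    (n xbar ybar zbar wbar U V x y z u v w : ℚ)
    (hn : n = a ^ 4 + 4 * b ^ 4)
    (hxbar : xbar = a ^ 8 + 24 * a ^ 4 * b ^ 4 + 16 * b ^ 8)
    (hybar : ybar = 4 * a * b * (4 * b ^ 4 - a ^ 4))
    (hzbar : zbar = a ^ 8 + 8 * a ^ 6 * b ^ 2 - 8 * a ^ 4 * b ^ 4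
      + 32 * a ^ 2 * b ^ 6 + 16 * b ^ 8)
    (hwbar : wbar = a ^ 8 - 8 * a ^ 6 * b ^ 2 - 8 * a ^ 4 * b ^ 4
      - 32 * a ^ 2 * b ^ 6 + 16 * b ^ 8)
    (hU : U = (xbar / ybar) ^ 2)
    (hV : V = xbar * zbar * wbar / ybar ^ 3)
    (hx : x = U ^ 2 + 2 * n * U - n ^ 2)
    (hy : y = U ^ 2 - 2 * n * U - n ^ 2)
    (hz : z = 4 * a * b * V)
    (hu : u = U ^ 2 + n ^ 2)
    (hv : v = 2 * a ^ 2 * V)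
    (hw : w = 4 * b ^ 2 * V) :
    x ^ 4 + y ^ 4 - z ^ 4 = 2 * u ^ 4 + 2 * v ^ 4 + 2 * w ^ 4 := by
  have hy0 : ybar ≠ 0 := by
    rw [hybar]
    intro h
    apply hab
    linear_combination h / 4
  -- the key polynomial factorisation
  have key : zbar ^ 2 * wbar ^ 2 = xbar ^ 4 - n ^ 2 * ybar ^ 4 := by
    rw [hzbar, hwbar, hxbar, hybar, hn]
    ring
  -- the point `(U, V)` lies on the congruent number curve
  have curve : V ^ 2 = U * (U ^ 2 - n ^ 2) := by
    rw [hU, hV]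
    field_simp
    linear_combination xbar ^ 2 * key
  have hn2 : a ^ 8 + 8 * a ^ 4 * b ^ 4 + 16 * b ^ 8 = n ^ 2 := by
    rw [hn]
    ring
  rw [hx, hy, hz, hu, hv, hw]
  linear_combination (-32 * n ^ 2) * (V ^ 2 + U * (U ^ 2 - n ^ 2)) * curve - 32 * V ^ 4 * hn2
end

section
/- For all rational numbers a, b, set n = a^4 + 4b^4, x̄ = a^8 + 24a^4b^4 + 16b^8, ȳ = 4ab(4b^4 - a^4), z̄ = a^8 + 8a^6b^2 - 8a^4b^4 + 32a^2b^6 + 16b^8, w̄ = a^8 - 8a^6b^2 - 8a^4b^4 - 32a^2b^6 + 16b^8. Then x = x̄^2, y = n·ȳ^2, z = z̄·w̄, u = 2ab·x̄·ȳ, v = 2b^2·x̄·ȳ, w = a^2·x̄·ȳ satisfy x^4 + y^4 - z^4 = u^4 + 2v^4 + 2w^4. -/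
/-- Theorem 1.1 (equation x⁴ + y⁴ - z⁴ = u⁴ + 2v⁴ + 2w⁴): explicit polynomial
parametric solution with parameters `a`, `b`. -/
theorem diag_quartic_param_xyz_u2v2w
    (a b : ℚ)
    (n xbar ybar zbar wbar x y z u v w : ℚ)
    (hn : n = a ^ 4 + 4 * b ^ 4)
    (hxbar : xbar = a ^ 8 + 24 * a ^ 4 * b ^ 4 + 16 * b ^ 8)
    (hybar : ybar = 4 * a * b * (4 * b ^ 4 - a ^ 4))
    (hzbar : zbar = a ^ 8 + 8 * a ^ 6 * b ^ 2 - 8 * a ^ 4 * b ^ 4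
      + 32 * a ^ 2 * b ^ 6 + 16 * b ^ 8)
    (hwbar : wbar = a ^ 8 - 8 * a ^ 6 * b ^ 2 - 8 * a ^ 4 * b ^ 4
      - 32 * a ^ 2 * b ^ 6 + 16 * b ^ 8)
    (hx : x = xbar ^ 2)
    (hy : y = n * ybar ^ 2)
    (hz : z = zbar * wbar)
    (hu : u = 2 * a * b * (xbar * ybar))
    (hv : v = 2 * b ^ 2 * (xbar * ybar))
    (hw : w = a ^ 2 * (xbar * ybar)) :
    x ^ 4 + y ^ 4 - z ^ 4 = u ^ 4 + 2 * v ^ 4 + 2 * w ^ 4 := by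
  have key : z ^ 2 = xbar ^ 4 - n ^ 2 * ybar ^ 4 := by
    rw [hz, hzbar, hwbar, hxbar, hn, hybar]
    ring
  have hz4 : z ^ 4 = (xbar ^ 4 - n ^ 2 * ybar ^ 4) ^ 2 := by
    rw [← key]
    ring
  rw [hz4, hx, hy, hu, hv, hw, hn]
  ring
end

section
/- There exist polynomials x, y, z, u, v, w in two variables over ℚ, each nonzero and not all constant, such that x^4 + y^4 + 4z^4 = u^4 + 2v^4 + 2w^4 holds identically (as an identity of polynomials). -/
open MvPolynomial

/-- Theorem 1.1 (equation x⁴ + y⁴ + 4z⁴ = u⁴ + 2v⁴ + 2w⁴): existence of a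
rational parametric (polynomial, two-parameter) solution. -/
theorem diag_quartic_param_xy4z_u2v2w :
    ∃ x y z u v w : MvPolynomial (Fin 2) ℚ,
      x ≠ 0 ∧ y ≠ 0 ∧ z ≠ 0 ∧ u ≠ 0 ∧ v ≠ 0 ∧ w ≠ 0 ∧
      ¬ (x.totalDegree = 0 ∧ y.totalDegree = 0 ∧ z.totalDegree = 0 ∧
         u.totalDegree = 0 ∧ v.totalDegree = 0 ∧ w.totalDegree = 0) ∧
      x ^ 4 + y ^ 4 + 4 * z ^ 4 = u ^ 4 + 2 * v ^ 4 + 2 * w ^ 4 := by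
  have key : ∀ (p : MvPolynomial (Fin 2) ℚ) (a b : ℚ), eval ![a, b] p ≠ 0 → p ≠ 0 := by
    intro p a b h hp
    exact h (by simp [hp])
  refine ⟨X 0 ^ 2 + X 1 ^ 2, X 0 ^ 2 - X 1 ^ 2, X 0 * X 1, 2 * (X 0 * X 1), X 0 ^ 2, X 1 ^ 2,
    key _ 2 1 ?_, key _ 2 1 ?_, key _ 2 1 ?_, key _ 2 1 ?_, key _ 2 1 ?_, key _ 2 1 ?_, ?_, ?_⟩
  · simp; norm_num
  · simp; norm_num
  · simp
  · simp
  · simp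
  · simp
  · rintro ⟨-, -, -, -, h, -⟩
    rw [totalDegree_X_pow] at h
    omega
  · ring
end

section
/- There exist polynomials x, y, z, u, v, w in two variables over ℚ, each nonzero and not all constant, such that x^4 + y^4 - 2z^4 = 2u^4 + 2v^4 + 2w^4 holds identically (as an identity of polynomials). -/
open MvPolynomial

namespace DiagQuartic

/-!
Idea: with `x = m²`, `y = n²`, `z = m n` the left side is `(m⁴ - n⁴)²`, while
`a⁴ + b⁴ + (a+b)⁴ = 2 (a² + a b + b²)²`.  With `m = s + t`, `n = s - t` it remains to make
`4 s t (s² + t²)` a norm `a² + a b + b²`; below `s`, `t` and `s² + t²` are all norms.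
-/

section
variable {R : Type*} [CommRing R] (n b : R)

def yy : R := n ^ 2 + 3 * b ^ 2 - 1
def aa : R := n ^ 2 - 3 * b ^ 2 + 1
def ss : R := 3 * (4 * n ^ 2 + yy n b ^ 2)
def tt : R := 16 * n ^ 2
def cc : R := 20 * n ^ 2 - 3 * yy n b ^ 2
def dd : R := 8 * n * yy n b
def pp : R := 4 * n * (6 * n * b * cc n b - 3 * aa n b * dd n b)
def rr : R := 4 * n * (6 * n * b * dd n b + aa n b * cc n b)

theorem norm_id : pp n b ^ 2 + 3 * rr n b ^ 2 =
    ss n b * tt n * (ss n b ^ 2 + tt n ^ 2) := by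
  simp only [pp, rr, ss, tt, cc, dd, aa, yy]; ring

theorem quartic_id (s t p r : R) (h : p ^ 2 + 3 * r ^ 2 = s * t * (s ^ 2 + t ^ 2)) :
    ((s + t) ^ 2) ^ 4 + ((s - t) ^ 2) ^ 4 - 2 * ((s + t) * (s - t)) ^ 4 =
      2 * (2 * (p - r)) ^ 4 + 2 * (4 * r) ^ 4 + 2 * (2 * (p + r)) ^ 4 := by
  linear_combination (-64) * (p ^ 2 + 3 * r ^ 2 + s * t * (s ^ 2 + t ^ 2)) * h
end

/-- Evaluation at the point `(1, c)`. -/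
noncomputable def ev (c : ℚ) : MvPolynomial (Fin 2) ℚ →+* ℚ := eval ![1, c]

theorem ne_zero_of_ev {q : MvPolynomial (Fin 2) ℚ} (h : ev 2 q ≠ 0) : q ≠ 0 := by
  rintro rfl; exact h (map_zero _)

end DiagQuartic

open DiagQuartic in
/-- Theorem 1.1 (equation x⁴ + y⁴ - 2z⁴ = 2u⁴ + 2v⁴ + 2w⁴): existence of a
rational parametric (polynomial, two-parameter) solution. -/
theorem diag_quartic_param_xy_neg2z_2u2v2w :
    ∃ x y z u v w : MvPolynomial (Fin 2) ℚ,
      x ≠ 0 ∧ y ≠ 0 ∧ z ≠ 0 ∧ u ≠ 0 ∧ v ≠ 0 ∧ w ≠ 0 ∧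
      ¬ (x.totalDegree = 0 ∧ y.totalDegree = 0 ∧ z.totalDegree = 0 ∧
         u.totalDegree = 0 ∧ v.totalDegree = 0 ∧ w.totalDegree = 0) ∧
      x ^ 4 + y ^ 4 - 2 * z ^ 4 = 2 * u ^ 4 + 2 * v ^ 4 + 2 * w ^ 4 := by
  refine ⟨(ss (X 0) (X 1) + tt (X 0)) ^ 2, (ss (X 0) (X 1) - tt (X 0)) ^ 2,
    (ss (X 0) (X 1) + tt (X 0)) * (ss (X 0) (X 1) - tt (X 0)),
    2 * (pp (X 0) (X 1) - rr (X 0) (X 1)), 4 * rr (X 0) (X 1),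
    2 * (pp (X 0) (X 1) + rr (X 0) (X 1)), ?_, ?_, ?_, ?_, ?_, ?_, ?_,
    quartic_id _ _ _ _ (norm_id _ _)⟩
  iterate 6
    · apply ne_zero_of_ev
      simp [ev, pp, rr, ss, tt, cc, dd, aa, yy]
      try norm_num
  · rintro ⟨h, -⟩
    rw [totalDegree_eq_zero_iff_eq_C] at h
    have h1 := congrArg (ev 1) h
    have h2 := congrArg (ev 2) h
    simp only [ev, eval_C] at h1 h2
    have h3 := h1.trans h2.symm
    simp [ss, tt, yy] at h3
    norm_num at h3
end

section
/- For all positive integers a and b, the number n = a^4 + 4b^4 is a congruent number; that is, there exist positive rational numbers p, q, r with p^2 + q^2 = r^2 and p·q = 2n. -/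
/-- Proposition 2.2(i): for positive integers `a`, `b`, the number
`a⁴ + 4b⁴` is a congruent number. -/
theorem congruent_a4_add_4b4 (a b : ℕ) (ha : 0 < a) (hb : 0 < b) :
    ∃ p q r : ℚ, 0 < p ∧ 0 < q ∧ 0 < r ∧
      p ^ 2 + q ^ 2 = r ^ 2 ∧ p * q = 2 * ((a : ℚ) ^ 4 + 4 * (b : ℚ) ^ 4) := by
  have hx : (0 : ℚ) < a := by exact_mod_cast ha
  have hy : (0 : ℚ) < b := by exact_mod_cast hb
  have hne : (a : ℚ) ^ 2 - 2 * (b : ℚ) ^ 2 ≠ 0 := by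
    intro h
    apply irrational_sqrt_two
    refine ⟨(a : ℚ) / b, ?_⟩
    symm
    rw [Real.sqrt_eq_iff_mul_self_eq (by norm_num) (by exact_mod_cast (div_pos hx hy).le)]
    have h2 : ((a : ℚ) / b) * (a / b) = 2 := by
      field_simp
      linarith
    exact_mod_cast h2.symm
  generalize (a : ℚ) = x at *
  generalize (b : ℚ) = y at *
  have hd0 : x ^ 4 - 4 * y ^ 4 ≠ 0 := by
    have : x ^ 4 - 4 * y ^ 4 = (x ^ 2 - 2 * y ^ 2) * (x ^ 2 + 2 * y ^ 2) := by ring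
    rw [this]
    exact mul_ne_zero hne (by positivity)
  obtain ⟨d, hd, hd2⟩ : ∃ d : ℚ, 0 < d ∧ d ^ 2 = (x ^ 4 - 4 * y ^ 4) ^ 2 :=
    ⟨|x ^ 4 - 4 * y ^ 4|, abs_pos.mpr hd0, sq_abs _⟩
  refine ⟨d / (2 * x * y), 4 * x * y * (x ^ 4 + 4 * y ^ 4) / d,
    ((x ^ 4 + 4 * y ^ 4) ^ 2 + (4 * x ^ 2 * y ^ 2) ^ 2) / (2 * x * y * d),
    by positivity, by positivity, by positivity, ?_, ?_⟩
  · have h4 : d ^ 4 = (x ^ 4 - 4 * y ^ 4) ^ 4 := by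
      calc d ^ 4 = (d ^ 2) ^ 2 := by ring
        _ = _ := by rw [hd2]; ring
    rw [div_pow, div_pow, div_pow, div_add_div _ _ (by positivity) (by positivity),
      div_eq_div_iff (by positivity) (by positivity)]
    have e : d ^ 2 * d ^ 2 = (x ^ 4 - 4 * y ^ 4) ^ 4 := by rw [← h4]; ring
    rw [e]
    ring
  · field_simp
    ring
end

section
/- For all positive integers a and b with a ≠ b, the number n = 2a^4 + 2b^4 is a congruent number; that is, there exist positive rational numbers p, q, r with p^2 + q^2 = r^2 and p·q = 2n. -/
/-- Proposition 2.2(ii): for distinct positive integers `a`, `b`, the number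
`2a⁴ + 2b⁴` is a congruent number. -/
theorem congruent_2a4_add_2b4 (a b : ℕ) (ha : 0 < a) (hb : 0 < b) (hab : a ≠ b) :
    ∃ p q r : ℚ, 0 < p ∧ 0 < q ∧ 0 < r ∧
      p ^ 2 + q ^ 2 = r ^ 2 ∧ p * q = 2 * (2 * (a : ℚ) ^ 4 + 2 * (b : ℚ) ^ 4) := by
  have hA : (0 : ℚ) < a := by exact_mod_cast ha
  have hB : (0 : ℚ) < b := by exact_mod_cast hb
  have hne : (a : ℚ) ^ 4 - (b : ℚ) ^ 4 ≠ 0 := by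
    intro h
    have h1 : a ^ 4 = b ^ 4 := by exact_mod_cast sub_eq_zero.mp h
    exact hab (Nat.pow_left_injective (by norm_num : 4 ≠ 0) h1)
  generalize (a : ℚ) = x at *
  generalize (b : ℚ) = y at *
  obtain ⟨d, hd, hd2⟩ : ∃ d : ℚ, 0 < d ∧ d ^ 2 = (x ^ 4 - y ^ 4) ^ 2 :=
    ⟨|x ^ 4 - y ^ 4|, abs_pos.mpr hne, sq_abs _⟩
  have hd4 : d ^ 4 = (x ^ 4 - y ^ 4) ^ 4 := by
    rw [show d ^ 4 = (d ^ 2) ^ 2 by ring, hd2]; ring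
  refine ⟨2 * x * y * (2 * x ^ 4 + 2 * y ^ 4) / d, d / (x * y),
    ((x ^ 2 + y ^ 2) ^ 4 + (x ^ 2 - y ^ 2) ^ 4) / (2 * x * y * d),
    by positivity, by positivity, by positivity, ?_, ?_⟩
  · have e : (2 * x * y * (2 * x ^ 4 + 2 * y ^ 4) / d) ^ 2 + (d / (x * y)) ^ 2
        = ((4 * x ^ 2 * y ^ 2 * (2 * x ^ 4 + 2 * y ^ 4)) ^ 2 + 4 * d ^ 4)
          / (2 * x * y * d) ^ 2 := by
      field_simp
      ring
    rw [e, hd4, div_pow]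
    congr 1
    ring
  · field_simp
end

section
/- For all positive integers a and b with a > b, the number n = a^4 - b^4 is a congruent number; that is, there exist positive rational numbers p, q, r with p^2 + q^2 = r^2 and p·q = 2n. -/
/-- Proposition 2.2(iii): for positive integers `a > b`, the number
`a⁴ - b⁴` is a congruent number. -/
theorem congruent_a4_sub_b4 (a b : ℕ) (hb : 0 < b) (hab : b < a) :
    ∃ p q r : ℚ, 0 < p ∧ 0 < q ∧ 0 < r ∧
      p ^ 2 + q ^ 2 = r ^ 2 ∧ p * q = 2 * ((a : ℚ) ^ 4 - (b : ℚ) ^ 4) := by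
  have hb' : (0 : ℚ) < b := by exact_mod_cast hb
  have hab' : (b : ℚ) < a := by exact_mod_cast hab
  have ha' : (0 : ℚ) < a := hb'.trans hab'
  have h4 : (b : ℚ) ^ 4 < (a : ℚ) ^ 4 := pow_lt_pow_left₀ hab' hb'.le (by norm_num)
  have hd : (0 : ℚ) < (a : ℚ) ^ 4 - (b : ℚ) ^ 4 := sub_pos.mpr h4
  refine ⟨((a : ℚ) ^ 4 - (b : ℚ) ^ 4) / (a * b), 2 * (a * b),
    ((a : ℚ) ^ 4 + (b : ℚ) ^ 4) / (a * b), div_pos hd (by positivity),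
    by positivity, by positivity, ?_, ?_⟩
  · field_simp
    ring
  · field_simp
end

section
/- Let n be a nonzero rational number and let u, v be rational numbers with v ≠ 0 and v^2 = u^3 - n^2 u. Then x₀ = u^2 + 2nu - n^2, y₀ = u^2 - 2nu - n^2, z₀ = u^2 + n^2, w₀ = 2v satisfy x₀^4 + y₀^4 = 2z₀^4 + 2n^2 w₀^4, and moreover x₀·y₀·z₀·w₀ ≠ 0. -/
theorem rat_sq_ne_two (q : ℚ) : q ^ 2 ≠ 2 := by
  intro h
  have h2 : IsSquare (2 : ℚ) := ⟨q, by rw [← h]; ring⟩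
  have h3 : ¬ IsSquare (2 : ℚ) := by
    rw [Rat.isSquare_iff]
    rintro ⟨h4, -⟩
    obtain ⟨r, hr⟩ := h4
    have hr' : (2 : ℤ) = r * r := by simpa using hr
    have : r < 2 := by nlinarith
    have : -2 < r := by nlinarith
    interval_cases r <;> omega
  exact h3 h2

theorem sq_ne_two_mul_sq (a n : ℚ) (hn : n ≠ 0) : a ^ 2 ≠ 2 * n ^ 2 := by
  intro h
  apply rat_sq_ne_two (a / n)
  rw [div_pow, h]
  field_simp

/-- Proposition 2.4: a rational point `(u, v)` with `v ≠ 0` on the elliptic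
curve `v² = u³ - n²u` yields a nontrivial rational solution of
`x⁴ + y⁴ = 2z⁴ + 2n²w⁴`. -/
theorem quartic_surface_point_of_elliptic
    (n u v : ℚ) (hn : n ≠ 0) (hv : v ≠ 0) (hcurve : v ^ 2 = u ^ 3 - n ^ 2 * u)
    (x₀ y₀ z₀ w₀ : ℚ)
    (hx : x₀ = u ^ 2 + 2 * n * u - n ^ 2)
    (hy : y₀ = u ^ 2 - 2 * n * u - n ^ 2)
    (hz : z₀ = u ^ 2 + n ^ 2)
    (hw : w₀ = 2 * v) :
    x₀ ^ 4 + y₀ ^ 4 = 2 * z₀ ^ 4 + 2 * n ^ 2 * w₀ ^ 4 ∧ x₀ * y₀ * z₀ * w₀ ≠ 0 := by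
  constructor
  · have h4 : v ^ 4 = (u ^ 3 - n ^ 2 * u) ^ 2 := by rw [← hcurve]; ring
    rw [hx, hy, hz, hw, mul_pow, h4]
    ring
  · refine mul_ne_zero (mul_ne_zero (mul_ne_zero ?_ ?_) ?_) ?_
    · intro h
      exact sq_ne_two_mul_sq (u + n) n hn (by linear_combination h - hx)
    · intro h
      exact sq_ne_two_mul_sq (u - n) n hn (by linear_combination h - hy)
    · rw [hz]
      positivity
    · rw [hw]
      positivity
end

section
/- Let n be a positive integer that is a congruent number, i.e., there exist positive rationals p, q, r with p^2 + q^2 = r^2 and p·q = 2n. Then there exist rational numbers x, y, z, w with x·y·z·w ≠ 0 such that x^4 + y^4 = z^4 + 2n^2 w^4. -/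
/-- Lemma 2.5: if `n` is a positive congruent number, then the diagonal quartic
surface `x⁴ + y⁴ = z⁴ + 2n²w⁴` has a nontrivial rational solution. -/
theorem quartic_surface_of_congruent (n : ℕ) (hn : 0 < n)
    (hcong : ∃ p q r : ℚ, 0 < p ∧ 0 < q ∧ 0 < r ∧
      p ^ 2 + q ^ 2 = r ^ 2 ∧ p * q = 2 * (n : ℚ)) :
    ∃ x y z w : ℚ, x * y * z * w ≠ 0 ∧
      x ^ 4 + y ^ 4 = z ^ 4 + 2 * (n : ℚ) ^ 2 * w ^ 4 := by
  obtain ⟨p, q, r, hp, hq, hr, h1, h2⟩ := hcong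
  have hn' : (n : ℚ) = p * q / 2 := by linarith
  have hpq : p ^ 2 - q ^ 2 ≠ 0 := by
    intro h
    have h3 : (r / p) ^ 2 = 2 := by
      rw [div_pow, div_eq_iff (by positivity)]
      linarith
    apply irrational_sqrt_two
    refine ⟨r / p, ?_⟩
    have h4 : (((r / p : ℚ) : ℝ)) ^ 2 = 2 := by exact_mod_cast h3
    have h5 : (0 : ℝ) ≤ ((r / p : ℚ) : ℝ) := by
      have : (0 : ℚ) ≤ r / p := by positivity
      exact_mod_cast this
    rw [← h4, Real.sqrt_sq h5]
  refine ⟨r ^ 2 / 4, n, (p ^ 2 - q ^ 2) / 4, r / 2, ?_, ?_⟩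
  · have : (n : ℚ) ≠ 0 := by positivity
    have := hr.ne'
    have h6 : (p ^ 2 - q ^ 2) / 4 ≠ 0 := div_ne_zero hpq (by norm_num)
    exact mul_ne_zero (mul_ne_zero (mul_ne_zero (by positivity) (by assumption)) h6) (by positivity)
  · have h7 : r ^ 4 = (p ^ 2 + q ^ 2) ^ 2 := by rw [h1]; ring
    rw [hn', ← h1, div_pow r, h7]
    ring
end

section
/- Let n be a nonzero rational number and suppose there exist rational numbers u, v with v ≠ 0 and v^2 = u^3 - n^2 u. Then there exist rational numbers x, y, z with x·y·z ≠ 0 such that x^4 + y^4 - 2z^4 = 2n^2. -/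
lemma no_sqrt_two_rat (a b : ℚ) (hb : b ≠ 0) : a ^ 2 ≠ 2 * b ^ 2 := by
  intro h
  have h2 : IsSquare (2 : ℚ) := ⟨a / b, by field_simp; linarith⟩
  have h3 : IsSquare (2 : ℕ) := by
    rw [← Rat.isSquare_natCast_iff]; exact_mod_cast h2
  exact Nat.prime_two.prime.not_isSquare h3

/-- Equation (33) in the proof of Theorem 1.4: a nontrivial rational point on
`v² = u³ - n²u` represents `2n²` in the form `x⁴ + y⁴ - 2z⁴`. -/
theorem two_n_sq_as_x4_y4_sub_2z4 (n : ℚ) (hn : n ≠ 0)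
    (h : ∃ u v : ℚ, v ≠ 0 ∧ v ^ 2 = u ^ 3 - n ^ 2 * u) :
    ∃ x y z : ℚ, x * y * z ≠ 0 ∧ x ^ 4 + y ^ 4 - 2 * z ^ 4 = 2 * n ^ 2 := by
  obtain ⟨u, v, hv, h⟩ := h
  have hv2 : 2 * v ≠ 0 := by simpa using hv
  refine ⟨(u ^ 2 - 2 * n * u - n ^ 2) / (2 * v), (u ^ 2 + 2 * n * u - n ^ 2) / (2 * v),
    (u ^ 2 + n ^ 2) / (2 * v), ?_, ?_⟩
  · refine mul_ne_zero (mul_ne_zero (div_ne_zero ?_ hv2) (div_ne_zero ?_ hv2))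
      (div_ne_zero ?_ hv2)
    · intro h0
      exact no_sqrt_two_rat (u - n) n hn (by linear_combination h0)
    · intro h0
      exact no_sqrt_two_rat (u + n) n hn (by linear_combination h0)
    · positivity
  · have hx : ((u ^ 2 - 2 * n * u - n ^ 2) / (2 * v)) ^ 2
        = ((u ^ 2 + n ^ 2) / (2 * v)) ^ 2 - n := by
      field_simp
      linear_combination 4 * n * h
    have hy : ((u ^ 2 + 2 * n * u - n ^ 2) / (2 * v)) ^ 2
        = ((u ^ 2 + n ^ 2) / (2 * v)) ^ 2 + n := by
      field_simp
      linear_combination -4 * n * h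
    generalize (u ^ 2 - 2 * n * u - n ^ 2) / (2 * v) = x at *
    generalize (u ^ 2 + 2 * n * u - n ^ 2) / (2 * v) = y at *
    generalize (u ^ 2 + n ^ 2) / (2 * v) = z at *
    linear_combination (x ^ 2 + z ^ 2 - n) * hx + (y ^ 2 + z ^ 2 + n) * hy
end

section
/- Let m ≥ 1, let k₁, …, k_m be rational numbers, and let a₁, a₂, b₁, …, b_m be nonzero elements of the rational function field ℚ(t) with a₁^4 ≠ a₂^4. Let f(x, y) be one of the three forms x^4 - y^4, x^4 + 4y^4, or 2x^4 + 2y^4, and suppose that f(a₁, a₂) = k₁ b₁^4 + ⋯ + k_m b_m^4 holds in ℚ(t). Then there exist nonzero rational functions x, y, z, w ∈ ℚ(t) such that x^4 + y^4 = 2z^4 + 2·(k₁ b₁^4 + ⋯ + k_m b_m^4)^2 · w^4 holds in ℚ(t). -/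
open RatFunc

theorem rf_sq_const (r : RatFunc ℚ) (c : ℚ) (h : r ^ 2 = RatFunc.C c) : ∃ s : ℚ, s ^ 2 = c := by
  have hd : r.denom ≠ 0 := r.denom_ne_zero
  have hd' : algebraMap (Polynomial ℚ) (RatFunc ℚ) r.denom ≠ 0 := by
    simpa using hd
  have h1 : r.num ^ 2 = Polynomial.C c * r.denom ^ 2 := by
    apply IsFractionRing.injective (Polynomial ℚ) (RatFunc ℚ)
    rw [map_mul, map_pow, map_pow, RatFunc.algebraMap_C, ← h]
    have h2 := RatFunc.num_div_denom r
    rw [div_eq_iff hd'] at h2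
    rw [h2]
    ring
  have h2 := congrArg Polynomial.leadingCoeff h1
  simp only [Polynomial.leadingCoeff_mul, Polynomial.leadingCoeff_pow,
    Polynomial.leadingCoeff_C] at h2
  have hl : r.denom.leadingCoeff ≠ 0 := by simpa using hd
  refine ⟨r.num.leadingCoeff / r.denom.leadingCoeff, ?_⟩
  field_simp
  linarith

theorem rf_two (p q : RatFunc ℚ) (hq : q ≠ 0) : p ^ 2 - 2 * q ^ 2 ≠ 0 := by
  intro h
  obtain ⟨s, hs⟩ := rf_sq_const (p / q) 2 (by
    rw [div_pow, div_eq_iff (pow_ne_zero 2 hq), map_ofNat]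
    linear_combination h)
  have h3 : IsSquare (2 : ℚ) := ⟨s, by rw [← hs]; ring⟩
  rw [Rat.isSquare_iff] at h3
  obtain ⟨⟨n, hn⟩, -⟩ := h3
  have hn' : n * n = 2 := by simpa using hn.symm
  have h4 : n < 2 := by nlinarith
  have h5 : -2 < n := by nlinarith
  interval_cases n <;> omega

theorem rf_one (p q : RatFunc ℚ) (hq : q ≠ 0) : p ^ 2 + q ^ 2 ≠ 0 := by
  intro h
  obtain ⟨s, hs⟩ := rf_sq_const (p / q) (-1) (by
    rw [div_pow, div_eq_iff (pow_ne_zero 2 hq), map_neg, map_one]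
    linear_combination h)
  nlinarith [sq_nonneg s]

theorem rf_main (N p q w : RatFunc ℚ) (hq : q ≠ 0) (hw : w ≠ 0)
    (h : p * q * (p - q) * (p + q) = N * w ^ 2) :
    ∃ x y z w : RatFunc ℚ, x ≠ 0 ∧ y ≠ 0 ∧ z ≠ 0 ∧ w ≠ 0 ∧
      x ^ 4 + y ^ 4 = 2 * z ^ 4 + 2 * N ^ 2 * w ^ 4 := by
  refine ⟨(p + q) ^ 2 - 2 * q ^ 2, (p - q) ^ 2 - 2 * q ^ 2, p ^ 2 + q ^ 2, 2 * w,
    rf_two _ _ hq, rf_two _ _ hq, rf_one _ _ hq, mul_ne_zero two_ne_zero hw, ?_⟩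
  linear_combination 32 * (p * q * (p - q) * (p + q) + N * w ^ 2) * h

/-- Theorem 1.2 (over ℚ(t)): if one of the forms `x⁴ - y⁴`, `x⁴ + 4y⁴`,
`2x⁴ + 2y⁴` is represented parametrically as `∑ kᵢ bᵢ⁴`, then
`x⁴ + y⁴ = 2z⁴ + 2(∑ kᵢ bᵢ⁴)² w⁴` has a rational parametric solution. -/
theorem theorem12_ratfunc (m : ℕ) (hm : 1 ≤ m) (k : Fin m → ℚ)
    (a₁ a₂ : RatFunc ℚ) (b : Fin m → RatFunc ℚ)
    (ha₁ : a₁ ≠ 0) (ha₂ : a₂ ≠ 0) (hb : ∀ i, b i ≠ 0)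
    (hne : a₁ ^ 4 ≠ a₂ ^ 4)
    (hf : a₁ ^ 4 - a₂ ^ 4 = ∑ i, RatFunc.C (k i) * (b i) ^ 4 ∨
          a₁ ^ 4 + 4 * a₂ ^ 4 = ∑ i, RatFunc.C (k i) * (b i) ^ 4 ∨
          2 * a₁ ^ 4 + 2 * a₂ ^ 4 = ∑ i, RatFunc.C (k i) * (b i) ^ 4) :
    ∃ x y z w : RatFunc ℚ, x ≠ 0 ∧ y ≠ 0 ∧ z ≠ 0 ∧ w ≠ 0 ∧
      x ^ 4 + y ^ 4 =
        2 * z ^ 4 + 2 * (∑ i, RatFunc.C (k i) * (b i) ^ 4) ^ 2 * w ^ 4 := by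
  generalize (∑ i, RatFunc.C (k i) * (b i) ^ 4) = N at hf ⊢
  have h2 : (2 : RatFunc ℚ) ≠ 0 := two_ne_zero
  rcases hf with rfl | rfl | rfl
  · exact rf_main _ (a₁ ^ 2) (a₂ ^ 2) (a₁ * a₂) (pow_ne_zero 2 ha₂) (mul_ne_zero ha₁ ha₂) (by ring)
  · refine rf_main _ (a₁ ^ 4 + 4 * a₂ ^ 4) ((2 * a₁ * a₂) ^ 2)
      (2 * a₁ * a₂ * ((a₁ ^ 2 - 2 * a₂ ^ 2) * (a₁ ^ 2 + 2 * a₂ ^ 2)))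
      (pow_ne_zero 2 (mul_ne_zero (mul_ne_zero h2 ha₁) ha₂))
      (mul_ne_zero (mul_ne_zero (mul_ne_zero h2 ha₁) ha₂)
        (mul_ne_zero (rf_two _ _ ha₂) ?_)) (by ring)
    intro h
    obtain ⟨s, hs⟩ := rf_sq_const (a₁ / a₂) (-2) (by
      rw [div_pow, div_eq_iff (pow_ne_zero 2 ha₂), map_neg, map_ofNat]
      linear_combination h)
    nlinarith [sq_nonneg s]
  · have h3 : a₁ ^ 4 - a₂ ^ 4 ≠ 0 := sub_ne_zero.mpr hne
    have h4 : a₁ ^ 2 - a₂ ^ 2 ≠ 0 := by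
      intro h
      apply h3
      linear_combination (a₁ ^ 2 + a₂ ^ 2) * h
    exact rf_main _ ((a₁ ^ 2 + a₂ ^ 2) ^ 2) ((a₁ ^ 2 - a₂ ^ 2) ^ 2)
      (2 * a₁ * a₂ * (a₁ ^ 4 - a₂ ^ 4)) (pow_ne_zero 2 h4)
      (mul_ne_zero (mul_ne_zero (mul_ne_zero h2 ha₁) ha₂) h3) (by ring)
end

section
/- There exist nonzero polynomials x, y, z, u, v, w in one variable over ℚ satisfying x^4 + y^4 + z^4 = u^4 + v^4 + w^4 identically, such that the multiset {x^4, y^4, z^4} is not equal to the multiset {u^4, v^4, w^4}. -/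
open Polynomial

/-- Corollary to Theorem 1.4: the equation `x⁴ + y⁴ + z⁴ = u⁴ + v⁴ + w⁴` has a
nontrivial rational parametric solution: the two sides do not agree term by
term as multisets of fourth powers. -/
theorem symmetric_three_fourth_powers_param :
    ∃ x y z u v w : Polynomial ℚ,
      x ≠ 0 ∧ y ≠ 0 ∧ z ≠ 0 ∧ u ≠ 0 ∧ v ≠ 0 ∧ w ≠ 0 ∧
      x ^ 4 + y ^ 4 + z ^ 4 = u ^ 4 + v ^ 4 + w ^ 4 ∧
      ({x ^ 4, y ^ 4, z ^ 4} : Multiset (Polynomial ℚ))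
        ≠ ({u ^ 4, v ^ 4, w ^ 4} : Multiset (Polynomial ℚ)) := by
  -- `a⁴ + b⁴ + (a+b)⁴ = 2 (a² + ab + b²)²`; both sides have `a² + ab + b² = 7 (X² + X + 1)`.
  have nz : ∀ p : Polynomial ℚ, p.eval 5 ≠ 0 → p ≠ 0 := by
    rintro p hp rfl
    simp at hp
  refine ⟨X - 2, 2 * X + 3, 3 * X + 1, 2 * X - 1, X + 3, 3 * X + 2,
    nz _ ?_, nz _ ?_, nz _ ?_, nz _ ?_, nz _ ?_, nz _ ?_, by ring, ?_⟩
  iterate 6 (simp; try norm_num)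
  intro h
  -- at `X = 2` the left side contains `0` and the right side does not
  have h2 := congrArg (Multiset.map (Polynomial.eval 2)) h
  have hm : (0 : ℚ) ∈ Multiset.map (Polynomial.eval 2)
      ({(X - 2) ^ 4, (2 * X + 3) ^ 4, (3 * X + 1) ^ 4} : Multiset (Polynomial ℚ)) := by
    simp
  rw [h2] at hm
  simp at hm
  norm_num at hm
end
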